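/- Let φ be a monotonic nonessential enhancement of site percolation on the square lattice ℤ². Then there exists a constant c₂ ∈ (0,∞), depending only on the enhancement, such that for every s ∈ [0,1] and every p ∈ (0, p_c): χ(p) ≤ χ(p,s) ≤ p^{−c₂} · χ(p), where χ(p) (resp. χ(p,s)) is the mean size of the open cluster of the origin before (resp. after) enhancement. -/

import Mathlib

open MeasureTheory Filter Set Topology
open scoped ENNReal

namespace PercEnh

/-- Sites of the lattice (vertex set `ℤ²`). -/
abbrev Site : Type := ℤ × ℤ

/-- A configuration: the set of open sites. -/
abbrev Config : Type := Set Site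

/-- Square-lattice (`ℤ²`-) adjacency: `‖x − y‖₁ = 1`. -/
def adjZ2 (x y : Site) : Prop := |x.1 - y.1| + |x.2 - y.2| = 1

/-- Matching (star) adjacency: `x ≠ y` and `‖x − y‖_∞ = 1`. -/
def adjStar (x y : Site) : Prop := x ≠ y ∧ max |x.1 - y.1| |x.2 - y.2| = 1

/-- Euclidean norm of a site. -/
noncomputable def siteNorm (x : Site) : ℝ := Real.sqrt ((x.1 : ℝ) ^ 2 + (x.2 : ℝ) ^ 2)

/-- Sites in the closed Euclidean ball of radius `r` centred at the origin. -/
def siteBall (r : ℝ) : Set Site := {x | siteNorm x ≤ r}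

/-- The shifted configuration `τ_x ω = {y − x : y ∈ ω}`. -/
def shiftConfig (x : Site) (ω : Config) : Config := {y | y + x ∈ ω}

/-- An enhancement function of (finite) range `R₀`: takes values in subsets of
`𝔹₀ = ℤ² ∩ B(R₀)` and depends only on the restriction of the configuration to `𝔹₀`. -/
def IsEnhancement (R₀ : ℝ) (φ : Config → Config) : Prop :=
  0 ≤ R₀ ∧ (∀ ω, φ ω ⊆ siteBall R₀) ∧
    ∀ ω ω' : Config, ω ∩ siteBall R₀ = ω' ∩ siteBall R₀ → φ ω = φ ω'

/-- A monotonic enhancement function. -/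
def Monotonic (φ : Config → Config) : Prop := ∀ ω ω' : Config, ω ⊆ ω' → φ ω ⊆ φ ω'

/-- The translate `φ_x(ω) = x + φ₀(τ_x ω)`. -/
def enhAt (φ : Config → Config) (x : Site) (ω : Config) : Config :=
  (fun z => z + x) '' φ (shiftConfig x ω)

/-- The enhanced configuration `ω̂(ω, α) = ω ∪ ⋃_{x : α(x)=1} φ_x(ω)`. -/
def enhanced (φ : Config → Config) (ω : Config) (α : Site → Bool) : Config :=
  ω ∪ {y | ∃ x, α x = true ∧ y ∈ enhAt φ x ω}

/-- The fully (deterministically, with `s = 1`) enhanced configuration `ω̃`. -/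
def fullyEnhanced (φ : Config → Config) (ω : Config) : Config :=
  ω ∪ {y | ∃ x, y ∈ enhAt φ x ω}

/-- `ω` contains a doubly-infinite self-repelling path (w.r.t. adjacency `adj`):
a two-sided sequence of distinct sites of `ω` in which exactly the consecutive
pairs are adjacent. -/
def HasDISRPath (adj : Site → Site → Prop) (ω : Config) : Prop :=
  ∃ γ : ℤ → Site, Function.Injective γ ∧ (∀ i, γ i ∈ ω) ∧
    ∀ i j : ℤ, adj (γ i) (γ j) ↔ (j = i + 1 ∨ i = j + 1)

/-- The enhancement is essential: some configuration without a doubly-infinite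
self-repelling path acquires one upon enhancement at the origin. -/
def Essential (adj : Site → Site → Prop) (φ : Config → Config) : Prop :=
  ∃ ω : Config, ¬ HasDISRPath adj ω ∧ HasDISRPath adj (ω ∪ φ ω)

/-- A (finite, nonempty) path w.r.t. adjacency `adj`: distinct sites,
consecutive ones adjacent. -/
def IsPathOn (adj : Site → Site → Prop) (l : List Site) : Prop :=
  l ≠ [] ∧ l.Nodup ∧ l.Chain' adj

/-- `x` and `y` are joined by a path of sites of `ω`. -/
def ConnectedIn (adj : Site → Site → Prop) (ω : Config) (x y : Site) : Prop :=
  ∃ l : List Site, IsPathOn adj l ∧ (∀ z ∈ l, z ∈ ω) ∧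
    l.head? = some x ∧ l.getLast? = some y

/-- `x` belongs to an infinite open cluster of `ω`. -/
def InInfiniteCluster (adj : Site → Site → Prop) (ω : Config) (x : Site) : Prop :=
  {y | ConnectedIn adj ω x y}.Infinite

/-- `ω` contains an infinite open cluster. -/
def HasInfiniteCluster (adj : Site → Site → Prop) (ω : Config) : Prop :=
  ∃ x, InInfiniteCluster adj ω x

/-- The configuration corresponding to `η : Site → Bool`. -/
def toConfig (η : Site → Bool) : Config := {x | η x = true}

/-- A cylinder event. -/
def cylinder (F : Finset Site) (b : Site → Bool) : Set (Site → Bool) :=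
  {η | ∀ x ∈ F, η x = b x}

/-- `μ` is the Bernoulli product measure with density `p` of open sites. -/
def IsBernoulli (p : ℝ) (μ : Measure (Site → Bool)) : Prop :=
  IsProbabilityMeasure μ ∧
    ∀ (F : Finset Site) (b : Site → Bool),
      μ (cylinder F b) = ∏ x ∈ F, ENNReal.ofReal (if b x then p else 1 - p)

/-- The percolation probability `θ`: the probability that the origin lies in an
infinite open cluster. -/
noncomputable def theta (adj : Site → Site → Prop) (μ : Measure (Site → Bool)) : ℝ :=
  (μ {η | InInfiniteCluster adj (toConfig η) 0}).toReal

/-- The percolation probability of the enhanced process (`μ` the law of the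
configuration, `ν` the law of the activation variables). -/
noncomputable def thetaEnh (adj : Site → Site → Prop) (φ : Config → Config)
    (μ ν : Measure (Site → Bool)) : ℝ :=
  ((μ.prod ν) {ηα | InInfiniteCluster adj (enhanced φ (toConfig ηα.1) ηα.2) 0}).toReal

/-- The critical point `p_c = sup {p ∈ [0,1] : θ(p) = 0}` for the family `P`. -/
noncomputable def pcOf (adj : Site → Site → Prop) (P : ℝ → Measure (Site → Bool)) : ℝ :=
  sSup {p | p ∈ Icc (0:ℝ) 1 ∧ theta adj (P p) = 0}

/-- The connectivity function `τ_p(x)`. -/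
noncomputable def tau (adj : Site → Site → Prop) (μ : Measure (Site → Bool)) (x : Site) : ℝ :=
  (μ {η | ConnectedIn adj (toConfig η) 0 x}).toReal

/-- The connectivity function `τ_{p,s}(x)` of the enhanced process. -/
noncomputable def tauEnh (adj : Site → Site → Prop) (φ : Config → Config)
    (μ ν : Measure (Site → Bool)) (x : Site) : ℝ :=
  ((μ.prod ν) {ηα | ConnectedIn adj (enhanced φ (toConfig ηα.1) ηα.2) 0 x}).toReal

/-- The mean cluster size `χ(p) = E_p‖C‖ = ∑_x τ_p(x)`. -/
noncomputable def chi (adj : Site → Site → Prop) (μ : Measure (Site → Bool)) : ℝ≥0∞ :=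
  ∑' x : Site, μ {η | ConnectedIn adj (toConfig η) 0 x}

/-- The mean cluster size of the enhanced process. -/
noncomputable def chiEnh (adj : Site → Site → Prop) (φ : Config → Config)
    (μ ν : Measure (Site → Bool)) : ℝ≥0∞ :=
  ∑' x : Site, (μ.prod ν) {ηα | ConnectedIn adj (enhanced φ (toConfig ηα.1) ηα.2) 0 x}


/-! ### The graph of open sites -/

/-- The subgraph of the square lattice induced by the open sites. -/
def openGraph (ω : Config) : SimpleGraph Site where
  Adj x y := adjZ2 x y ∧ x ∈ ω ∧ y ∈ ω
  symm := ⟨fun x y h => ⟨by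
    have := h.1
    unfold adjZ2 at *
    rwa [abs_sub_comm y.1, abs_sub_comm y.2], h.2.2, h.2.1⟩⟩
  loopless := ⟨fun x h => by simpa [adjZ2] using h.1⟩

/-- The supremum norm of a site. -/
def supNorm (x : Site) : ℕ := max x.1.natAbs x.2.natAbs

theorem adjZ2_iff_natAbs {x y : Site} :
    adjZ2 x y ↔ (x.1 - y.1).natAbs + (x.2 - y.2).natAbs = 1 := by
  unfold adjZ2
  rw [Int.abs_eq_natAbs, Int.abs_eq_natAbs]
  omega

theorem adjZ2_comm {x y : Site} : adjZ2 x y ↔ adjZ2 y x := by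
  simp only [adjZ2_iff_natAbs]
  omega

theorem not_adjZ2_self (x : Site) : ¬ adjZ2 x x := by
  simp [adjZ2]

theorem supNorm_le_of_adjZ2 {x y : Site} (h : adjZ2 x y) : supNorm x ≤ supNorm y + 1 := by
  rw [adjZ2_iff_natAbs] at h
  unfold supNorm
  omega

theorem openGraph_mono {ω ω' : Config} (h : ω ⊆ ω') : openGraph ω ≤ openGraph ω' :=
  fun _ _ hxy => ⟨hxy.1, h hxy.2.1, h hxy.2.2⟩

theorem reachable_of_isChain {ω : Config} {x y : Site} {l : List Site}
    (hchain : (x :: l).IsChain adjZ2) (hmem : ∀ z ∈ x :: l, z ∈ ω)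
    (hlast : (x :: l).getLast? = some y) : (openGraph ω).Reachable x y := by
  induction l generalizing x with
  | nil =>
    obtain rfl : x = y := by simpa using hlast
    exact .refl _
  | cons z l ih =>
    rw [List.isChain_cons_cons] at hchain
    have hadj : (openGraph ω).Adj x z := ⟨hchain.1, hmem x (by simp), hmem z (by simp)⟩
    exact hadj.reachable.trans
      (ih hchain.2 (fun w hw => hmem w (List.mem_cons_of_mem _ hw)) (by simpa using hlast))

theorem connectedIn_iff {ω : Config} {x y : Site} :
    ConnectedIn adjZ2 ω x y ↔ x ∈ ω ∧ (openGraph ω).Reachable x y := by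
  constructor
  · rintro ⟨l, ⟨hne, -, hchain⟩, hmem, hhead, hlast⟩
    obtain ⟨z, l, rfl⟩ := List.exists_cons_of_ne_nil hne
    obtain rfl : z = x := by simpa using hhead
    exact ⟨hmem z (by simp), reachable_of_isChain hchain hmem hlast⟩
  · rintro ⟨hx, hxy⟩
    obtain ⟨p, hp⟩ := hxy.exists_isPath
    refine ⟨p.support, ⟨p.support_ne_nil, hp.support_nodup, ?_⟩, ?_, ?_, ?_⟩
    · exact p.isChain_adj_support.imp fun _ _ h => h.1
    · clear hp hxy
      induction p with
      | nil => simpa using hx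
      | cons h p ih => simpa [hx] using ih h.2.2
    · rw [List.head?_eq_some_head p.support_ne_nil, p.head_support]
    · rw [List.getLast?_eq_some_getLast p.support_ne_nil, p.getLast_support]

theorem ConnectedIn.mono {ω ω' : Config} (h : ω ⊆ ω') {x y : Site}
    (hxy : ConnectedIn adjZ2 ω x y) : ConnectedIn adjZ2 ω' x y := by
  rw [connectedIn_iff] at *
  exact ⟨h hxy.1, hxy.2.mono (openGraph_mono h)⟩

/-- A set of sites which is closed under open steps is closed under reachability. -/
theorem reachable_induction {ω : Config} {x y : Site} (Q : Site → Prop)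
    (hxy : (openGraph ω).Reachable x y) (hx : Q x)
    (hstep : ∀ z w, adjZ2 z w → z ∈ ω → w ∈ ω → Q z → Q w) : Q y := by
  rw [SimpleGraph.reachable_iff_reflTransGen] at hxy
  induction hxy with
  | refl => exact hx
  | tail _ h ih => exact hstep _ _ h.1 h.2.1 h.2.2 ih

/-- Two joined open sites are joined by a self-repelling path. -/
theorem exists_selfRepelling {ω : Config} {x y : Site} (hxy : (openGraph ω).Reachable x y)
    (hx : x ∈ ω) :
    ∃ (n : ℕ) (γ : ℕ → Site), γ 0 = x ∧ γ n = y ∧ (∀ i ≤ n, γ i ∈ ω) ∧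
      ∀ i ≤ n, ∀ j ≤ n, adjZ2 (γ i) (γ j) ↔ (j = i + 1 ∨ i = j + 1) := by
  obtain ⟨p, hp⟩ := hxy.exists_walk_length_eq_dist
  have hmem : ∀ i ≤ p.length, p.getVert i ∈ ω := by
    intro i hi
    rcases Nat.eq_zero_or_pos i with rfl | hi0
    · simpa using hx
    · obtain ⟨k, rfl⟩ := Nat.exists_eq_add_of_lt hi0
      have := p.adj_getVert_succ (i := k) (by omega)
      simpa using this.2.2
  have hdist : ∀ i ≤ p.length, (openGraph ω).dist x (p.getVert i) = i := by
    intro i hi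
    have h₁ := SimpleGraph.dist_le (p.take i)
    have h₂ := SimpleGraph.dist_le (p.drop i)
    have h₃ := (p.drop i).reachable.dist_triangle_right x
    rw [SimpleGraph.Walk.take_length] at h₁
    rw [SimpleGraph.Walk.drop_length] at h₂
    omega
  refine ⟨p.length, p.getVert, by simp, by simp, hmem, fun i hi j hj => ⟨fun h => ?_, ?_⟩⟩
  · have hadj : (openGraph ω).Adj (p.getVert i) (p.getVert j) := ⟨h, hmem i hi, hmem j hj⟩
    have h₁ := hadj.reachable.dist_triangle_right x
    have h₂ := hadj.symm.reachable.dist_triangle_right x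
    rw [SimpleGraph.dist_eq_one_iff_adj.mpr hadj, hdist i hi, hdist j hj] at h₁
    rw [SimpleGraph.dist_eq_one_iff_adj.mpr hadj.symm, hdist i hi, hdist j hj] at h₂
    have : i ≠ j := by
      rintro rfl
      exact not_adjZ2_self _ h
    omega
  · rintro (rfl | rfl)
    · exact (p.adj_getVert_succ (by omega)).1
    · exact (p.adj_getVert_succ (by omega)).symm.1

/-! ### Outward rays -/

/-- The straight ray from `u` pointing away from the square centred at the origin which has
`u` on its boundary. -/
def ray (u : Site) (k : ℕ) : Site :=
  if u.1 = supNorm u then (u.1 + k, u.2)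
  else if u.1 = -supNorm u then (u.1 - k, u.2)
  else if u.2 = supNorm u then (u.1, u.2 + k)
  else (u.1, u.2 - k)

theorem ray_zero (u : Site) : ray u 0 = u := by
  simp [ray]

theorem supNorm_ray (u : Site) (k : ℕ) : supNorm (ray u k) = supNorm u + k := by
  unfold ray
  split_ifs <;> unfold supNorm at * <;> dsimp only <;> omega

theorem adjZ2_ray_ray (u : Site) (i j : ℕ) :
    adjZ2 (ray u i) (ray u j) ↔ (j = i + 1 ∨ i = j + 1) := by
  unfold ray
  rw [adjZ2_iff_natAbs]
  split_ifs <;> dsimp only <;> omega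

theorem bounds_of_supNorm_eq {u : Site} {R : ℕ} (h : supNorm u = R) :
    -(R : ℤ) ≤ u.1 ∧ u.1 ≤ R ∧ -(R : ℤ) ≤ u.2 ∧ u.2 ≤ R ∧
      (u.1 ≠ R → u.1 ≠ -R → u.2 ≠ R → u.2 = -R) := by
  unfold supNorm at h
  omega

/-- Rays starting from distinct, non-adjacent boundary sites of a square are at distance at
least two. -/
theorem two_le_dist_ray_ray {u v : Site} (huv : supNorm u = supNorm v) (hne : u ≠ v)
    (hadj : ¬ adjZ2 u v) (i j : ℕ) :
    2 ≤ ((ray u i).1 - (ray v j).1).natAbs + ((ray u i).2 - (ray v j).2).natAbs := by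
  obtain ⟨R, hR⟩ : ∃ R, supNorm v = R := ⟨_, rfl⟩
  obtain ⟨hu₁, hu₂, hu₃, hu₄, hu₅⟩ := bounds_of_supNorm_eq (huv.trans hR)
  obtain ⟨hv₁, hv₂, hv₃, hv₄, hv₅⟩ := bounds_of_supNorm_eq hR
  have hdist : 2 ≤ (u.1 - v.1).natAbs + (u.2 - v.2).natAbs := by
    rw [adjZ2_iff_natAbs] at hadj
    rw [Ne, Prod.ext_iff] at hne
    omega
  unfold ray
  rw [huv, hR]
  clear huv hR hne hadj
  split_ifs <;> dsimp only <;> omega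

theorem ray_ne_ray {u v : Site} (huv : supNorm u = supNorm v) (hne : u ≠ v)
    (hadj : ¬ adjZ2 u v) (i j : ℕ) : ray u i ≠ ray v j := by
  intro h
  have := two_le_dist_ray_ray huv hne hadj i j
  rw [h] at this
  omega

theorem not_adjZ2_ray_ray {u v : Site} (huv : supNorm u = supNorm v) (hne : u ≠ v)
    (hadj : ¬ adjZ2 u v) (i j : ℕ) : ¬ adjZ2 (ray u i) (ray v j) := by
  have := two_le_dist_ray_ray huv hne hadj i j
  rw [adjZ2_iff_natAbs]
  omega

/-! ### Doubly-infinite self-repelling paths through a square -/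

/-- A self-repelling path crossing a square, continued along the outward rays from its
endpoints, is a doubly-infinite self-repelling path. -/
theorem hasDISRPath_of_crossing {R : ℕ} {ω : Config} {u v : Site} (hu : supNorm u = R)
    (hv : supNorm v = R) (hne : u ≠ v) (hadj : ¬ adjZ2 u v)
    (hin : ∀ z ∈ ω, supNorm z < R ∨ z = u ∨ z = v) (huω : u ∈ ω)
    (huv : (openGraph ω).Reachable u v) :
    HasDISRPath adjZ2 (ω ∪ (range (ray u) ∪ range (ray v))) := by
  obtain ⟨n, γ, h0, hn, hmem, hγ⟩ := exists_selfRepelling huv huω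
  have hinner : ∀ i ≤ n, 0 < i → i < n → supNorm (γ i) < R := by
    intro i hi hi0 hi_le
    rcases hin _ (hmem i hi) with h | h | h
    · exact h
    · have h₁ := hγ i hi (i + 1) (by omega)
      have h₂ := hγ 0 (by omega) (i + 1) (by omega)
      rw [h, ← h0, h₂] at h₁
      omega
    · have h₁ := hγ (i - 1) (by omega) i hi
      have h₂ := hγ (i - 1) (by omega) n le_rfl
      rw [h, ← hn, h₂] at h₁
      omega
  have hn1 : 2 ≤ n := by
    by_contra hlt
    obtain rfl | rfl : n = 0 ∨ n = 1 := by omega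
    · exact hne (h0.symm.trans hn)
    · have := hγ 0 (by omega) 1 le_rfl
      rw [h0, hn] at this
      exact hadj (this.2 (by omega))
  let Γ : ℤ → Site := fun i =>
    if i ≤ 0 then ray u (-i).toNat else if i < n then γ i.toNat else ray v (i - n).toNat
  have hA : ∀ i ≤ 0, Γ i = ray u (-i).toNat := fun i hi => if_pos hi
  have hB : ∀ i : ℤ, 0 ≤ i → i ≤ n → Γ i = γ i.toNat := by
    intro i hi hi_le
    rcases eq_or_lt_of_le hi with rfl | hi0
    · simp [Γ, ray_zero, h0]
    rcases eq_or_lt_of_le hi_le with rfl | hi_le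
    · have : n ≠ 0 := by omega
      simp [Γ, this, ray_zero, hn]
    · have : ¬ i ≤ 0 := by omega
      simp [Γ, this, hi_le]
  have hC : ∀ i : ℤ, n ≤ i → Γ i = ray v (i - n).toNat := by
    intro i hi
    have h₁ : ¬ i ≤ 0 := by omega
    have h₂ : ¬ i < n := by omega
    simp [Γ, h₁, h₂]
  have hlt : ∀ i j : ℤ, i < j → (adjZ2 (Γ i) (Γ j) ↔ j = i + 1) := by
    intro i j hij
    rcases le_or_gt j 0 with hj | hj
    · rw [hA i (by omega), hA j hj, adjZ2_ray_ray]
      omega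
    rcases le_or_gt (n : ℤ) i with hi | hi
    · rw [hC i hi, hC j (by omega), adjZ2_ray_ray]
      omega
    rcases le_or_gt 0 i with hi0 | hi0
    · rcases le_or_gt j n with hjn | hjn
      · rw [hB i hi0 (by omega), hB j hj.le hjn, hγ _ (by omega) _ (by omega)]
        omega
      · refine iff_of_false (fun h => ?_) (by omega)
        rcases eq_or_lt_of_le hi0 with rfl | hi0
        · rw [hA 0 le_rfl, hC j hjn.le] at h
          exact not_adjZ2_ray_ray (hu.trans hv.symm) hne hadj _ _ h
        · rw [hB i hi0.le (by omega), hC j hjn.le] at h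
          have h₁ := supNorm_le_of_adjZ2 (adjZ2_comm.1 h)
          have h₂ := hinner i.toNat (by omega) (by omega) (by omega)
          rw [supNorm_ray, hv] at h₁
          omega
    · refine iff_of_false (fun h => ?_) (by omega)
      rcases le_or_gt (n : ℤ) j with hjn | hjn
      · rw [hA i hi0.le, hC j hjn] at h
        exact not_adjZ2_ray_ray (hu.trans hv.symm) hne hadj _ _ h
      · rw [hA i hi0.le, hB j hj.le hjn.le] at h
        have h₁ := supNorm_le_of_adjZ2 h
        have h₂ := hinner j.toNat (by omega) (by omega) (by omega)
        rw [supNorm_ray, hu] at h₁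
        omega
  have hiff : ∀ i j : ℤ, adjZ2 (Γ i) (Γ j) ↔ (j = i + 1 ∨ i = j + 1) := by
    intro i j
    rcases lt_trichotomy i j with h | rfl | h
    · rw [hlt i j h]
      omega
    · exact iff_of_false (not_adjZ2_self _) (by omega)
    · rw [adjZ2_comm, hlt j i h]
      omega
  refine ⟨Γ, fun i j h => ?_, fun i => ?_, hiff⟩
  · have h₁ := (hiff i (i + 1)).2 (by omega)
    have h₂ := (hiff i (i - 1)).2 (by omega)
    rw [h, hiff] at h₁ h₂
    omega
  · rcases le_or_gt i 0 with hi | hi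
    · exact .inr (.inl ⟨_, (hA i hi).symm⟩)
    rcases le_or_gt (n : ℤ) i with hi' | hi'
    · exact .inr (.inr ⟨_, (hC i hi').symm⟩)
    · rw [hB i hi.le hi'.le]
      exact .inl (hmem _ (by omega))

/-- A one-sided infinite path of distinct sites meets every large sphere. -/
theorem exists_supNorm_eq {γ : ℕ → Site} (hγ : Function.Injective γ)
    (hadj : ∀ i, adjZ2 (γ i) (γ (i + 1))) {M : ℕ} (hM : supNorm (γ 0) < M) :
    ∃ i, 0 < i ∧ supNorm (γ i) = M := by
  have hex : ∃ i, M ≤ supNorm (γ i) := by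
    by_contra! h
    refine not_injective_infinite_finite (fun i => (⟨γ i, ?_⟩ :
      (Set.Icc (-(M : ℤ)) M ×ˢ Set.Icc (-(M : ℤ)) M : Set Site))) (fun i j hij => ?_)
    · have := h i
      unfold supNorm at this
      simp only [Set.mem_prod, Set.mem_Icc]
      omega
    · exact hγ (congrArg Subtype.val hij)
  classical
  have hspec := Nat.find_spec hex
  have hpos : 0 < Nat.find hex := by
    by_contra! h0
    rw [Nat.le_zero.1 h0] at hspec
    omega
  refine ⟨Nat.find hex, hpos, le_antisymm ?_ hspec⟩
  have hmin := Nat.find_min hex (Nat.sub_lt hpos one_pos)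
  have hstep := hadj (Nat.find hex - 1)
  rw [Nat.sub_add_cancel hpos] at hstep
  have := supNorm_le_of_adjZ2 (adjZ2_comm.1 hstep)
  omega

theorem reachable_of_path {ω : Config} {γ : ℤ → Site} (hmem : ∀ i, γ i ∈ ω)
    (hadj : ∀ i, adjZ2 (γ i) (γ (i + 1))) (i : ℤ) (n : ℕ) :
    (openGraph ω).Reachable (γ i) (γ (i + n)) := by
  induction n with
  | zero => simp
  | succ n ih =>
    have hstep : (openGraph ω).Adj (γ (i + n)) (γ (i + n + 1)) := ⟨hadj _, hmem _, hmem _⟩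
    push_cast
    rw [← add_assoc]
    exact ih.trans hstep.reachable

/-- If the sites of `ω` inside a square, together with two outward rays, contain a
doubly-infinite self-repelling path, then the starting points of the rays are joined in `ω`. -/
theorem reachable_of_hasDISRPath {R : ℕ} {ω : Config} {u v : Site} (hu : supNorm u = R)
    (hv : supNorm v = R) (hne : u ≠ v) (hadj : ¬ adjZ2 u v) (huω : u ∈ ω) (hvω : v ∈ ω)
    (h : HasDISRPath adjZ2 ({z ∈ ω | supNorm z < R} ∪ (range (ray u) ∪ range (ray v)))) :
    (openGraph ω).Reachable u v := by
  obtain ⟨γ, hinj, hmem, hγ⟩ := h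
  set ω' : Config := {z ∈ ω | supNorm z < R} ∪ (range (ray u) ∪ range (ray v))
  have hrays := not_adjZ2_ray_ray (hu.trans hv.symm) hne hadj
  set k : ℕ := supNorm (γ 0) + 1
  obtain ⟨i, hi0, hi⟩ := exists_supNorm_eq (γ := fun n => γ n) (M := R + k)
    (fun a b hab => by simpa using hinj hab) (fun a => (hγ _ _).2 (by left; push_cast; rfl))
    (by simp only [Nat.cast_zero]; omega)
  obtain ⟨j, hj0, hj⟩ := exists_supNorm_eq (γ := fun n => γ (-n)) (M := R + k)
    (fun a b hab => by simpa using hinj hab)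
    (fun a => (hγ _ _).2 (by right; push_cast; ring))
    (by simp only [Nat.cast_zero, neg_zero]; omega)
  have hsphere : ∀ z ∈ ω', supNorm z = R + k → z = ray u k ∨ z = ray v k := by
    rintro z (⟨-, hz⟩ | ⟨m, rfl⟩ | ⟨m, rfl⟩) hzk
    · omega
    · rw [supNorm_ray, hu] at hzk
      exact .inl (by rw [Nat.add_left_cancel hzk])
    · rw [supNorm_ray, hv] at hzk
      exact .inr (by rw [Nat.add_left_cancel hzk])
  have hij : (openGraph ω').Reachable (γ (-j)) (γ i) := by
    have := reachable_of_path hmem (fun a => (hγ a (a + 1)).2 (.inl rfl)) (-j) (j + i)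
    rwa [show (-(j : ℤ) + ((j + i : ℕ) : ℤ)) = i by push_cast; ring] at this
  have hneq : γ (-j) ≠ γ i := fun h => by
    have := hinj h
    omega
  have huv : (openGraph ω').Reachable (ray u k) (ray v k) := by
    rcases hsphere _ (hmem i) hi with h₁ | h₁ <;> rcases hsphere _ (hmem (-j)) hj with h₂ | h₂
    · exact absurd (h₂.trans h₁.symm) hneq
    · rw [h₁, h₂] at hij
      exact hij.symm
    · rwa [h₁, h₂] at hij
    · exact absurd (h₂.trans h₁.symm) hneq
  by_contra hcon
  have hQ := reachable_induction
    (fun z => z ∈ range (ray u) ∨ (supNorm z < R ∧ (openGraph ω).Reachable u z)) huv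
    (.inl ⟨k, rfl⟩) ?_
  · rcases hQ with ⟨m, hm⟩ | ⟨hlt, -⟩
    · exact ray_ne_ray (hu.trans hv.symm) hne hadj _ _ hm
    · rw [supNorm_ray, hv] at hlt
      omega
  · intro z w hzw hz hw hQz
    rcases hw with ⟨hw, hwR⟩ | hw | ⟨m, rfl⟩
    · refine .inr ⟨hwR, ?_⟩
      rcases hQz with ⟨l, rfl⟩ | ⟨hzR, hzu⟩
      · have := supNorm_le_of_adjZ2 hzw
        rw [supNorm_ray, hu] at this
        obtain rfl : l = 0 := by omega
        rw [ray_zero] at hzw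
        exact SimpleGraph.Adj.reachable ⟨hzw, huω, hw⟩
      · rcases hz with ⟨hz, -⟩ | ⟨l, rfl⟩ | ⟨l, rfl⟩
        · exact hzu.trans (SimpleGraph.Adj.reachable ⟨hzw, hz, hw⟩)
        · rw [supNorm_ray] at hzR
          omega
        · rw [supNorm_ray] at hzR
          omega
    · exact .inl hw
    · exfalso
      rcases hQz with ⟨l, rfl⟩ | ⟨hzR, hzu⟩
      · exact hrays _ _ hzw
      · have := supNorm_le_of_adjZ2 (adjZ2_comm.1 hzw)
        rw [supNorm_ray, hv] at this
        obtain rfl : m = 0 := by omega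
        rw [ray_zero] at hzw
        rcases hz with ⟨hz, -⟩ | ⟨l, rfl⟩ | ⟨l, rfl⟩
        · exact hcon (hzu.trans (SimpleGraph.Adj.reachable ⟨hzw, hz, hvω⟩))
        · rw [supNorm_ray] at hzR
          omega
        · rw [supNorm_ray] at hzR
          omega

/-! ### Enhancements at a single site -/

theorem supNorm_le_siteNorm (x : Site) : (supNorm x : ℝ) ≤ siteNorm x := by
  unfold supNorm siteNorm
  rw [Nat.cast_max]
  refine max_le ?_ ?_ <;> refine Real.le_sqrt_of_sq_le ?_ <;>
    rw [Nat.cast_natAbs, Int.cast_abs, sq_abs] <;> nlinarith [sq_nonneg (x.1 : ℝ),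
      sq_nonneg (x.2 : ℝ)]

theorem supNorm_lt_of_mem_siteBall {R₀ : ℝ} {R : ℕ} (hR : R₀ < R) {x : Site}
    (hx : x ∈ siteBall R₀) : supNorm x < R := by
  have h : siteNorm x ≤ R₀ := hx
  exact_mod_cast ((supNorm_le_siteNorm x).trans h).trans_lt hR

/-- A nonessential enhancement at the origin does not create new crossings of a square around
the origin. -/
theorem reachable_of_reachable_square {R₀ : ℝ} {φ : Config → Config} (hφ : IsEnhancement R₀ φ)
    (hness : ¬ Essential adjZ2 φ) {R : ℕ} (hR : R₀ < R) {ω : Config} {u v : Site}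
    (hu : supNorm u = R) (hv : supNorm v = R) (huω : u ∈ ω) (hvω : v ∈ ω)
    (huv : (openGraph {z ∈ ω ∪ φ ω | supNorm z < R ∨ z = u ∨ z = v}).Reachable u v) :
    (openGraph ω).Reachable u v := by
  by_cases hne : u = v
  · rw [hne]
  by_cases hadj : adjZ2 u v
  · exact SimpleGraph.Adj.reachable ⟨hadj, huω, hvω⟩
  set ω' : Config := {z ∈ ω | supNorm z < R} ∪ (range (ray u) ∪ range (ray v))
  have hrays : ∀ z ∈ range (ray u) ∪ range (ray v), R ≤ supNorm z := by
    rintro z (⟨k, rfl⟩ | ⟨k, rfl⟩) <;> rw [supNorm_ray] <;> omega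
  have hφω' : φ ω' = φ ω := by
    refine hφ.2.2 _ _ (Set.ext fun z => and_congr_left fun hz => ?_)
    have hzR := supNorm_lt_of_mem_siteBall hR hz
    refine ⟨?_, fun h => .inl ⟨h, hzR⟩⟩
    rintro (h | h)
    · exact h.1
    · exact absurd (hrays z h) (by omega)
  refine reachable_of_hasDISRPath hu hv hne hadj huω hvω ?_
  by_contra hno
  refine hness ⟨ω', hno, ?_⟩
  have huS : u ∈ {z ∈ ω ∪ φ ω | supNorm z < R ∨ z = u ∨ z = v} := ⟨.inl huω, .inr (.inl rfl)⟩
  obtain ⟨γ, hinj, hmem, hγ⟩ :=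
    hasDISRPath_of_crossing hu hv hne hadj (fun z hz => hz.2) huS huv
  refine ⟨γ, hinj, fun i => ?_, hγ⟩
  rw [hφω']
  rcases hmem i with ⟨h | h, h' | h' | h'⟩ | h
  · exact .inl (.inl ⟨h, h'⟩)
  · exact .inl (.inr (.inl ⟨0, by rw [ray_zero, h']⟩))
  · exact .inl (.inr (.inr ⟨0, by rw [ray_zero, h']⟩))
  · exact .inr h
  · exact .inr h
  · exact .inr h
  · exact .inl (.inr h)

/-- A nonessential enhancement at the origin does not join sites far from the origin which were
not already joined. -/
theorem reachable_of_reachable_union {R₀ : ℝ} {φ : Config → Config} (hφ : IsEnhancement R₀ φ)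
    (hness : ¬ Essential adjZ2 φ) {R : ℕ} (hR : R₀ < R) {ω : Config} {a b : Site}
    (ha : R ≤ supNorm a) (hb : R ≤ supNorm b) (hab : (openGraph (ω ∪ φ ω)).Reachable a b) :
    (openGraph ω).Reachable a b := by
  have hout : ∀ z ∈ ω ∪ φ ω, R ≤ supNorm z → z ∈ ω := by
    rintro z (hz | hz) hzR
    · exact hz
    · exact absurd (supNorm_lt_of_mem_siteBall hR (hφ.2.1 ω hz)) (by omega)
  suffices key : (R ≤ supNorm b → (openGraph ω).Reachable a b) ∧
      (supNorm b < R → ∃ u ∈ ω, supNorm u = R ∧ (openGraph ω).Reachable a u ∧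
        (openGraph {z ∈ ω ∪ φ ω | supNorm z < R ∨ z = u}).Reachable u b) from key.1 hb
  refine reachable_induction (fun w => (R ≤ supNorm w → (openGraph ω).Reachable a w) ∧
    (supNorm w < R → ∃ u ∈ ω, supNorm u = R ∧ (openGraph ω).Reachable a u ∧
      (openGraph {z ∈ ω ∪ φ ω | supNorm z < R ∨ z = u}).Reachable u w)) hab
    ⟨fun _ => .refl _, fun h => absurd h (by omega)⟩ ?_
  intro z w hzw hz hw hQ
  have h₁ := supNorm_le_of_adjZ2 hzw
  have h₂ := supNorm_le_of_adjZ2 (adjZ2_comm.1 hzw)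
  refine ⟨fun hwR => ?_, fun hwR => ?_⟩
  · have hwω := hout w hw hwR
    rcases le_or_gt R (supNorm z) with hzR | hzR
    · exact (hQ.1 hzR).trans (SimpleGraph.Adj.reachable ⟨hzw, hout z hz hzR, hwω⟩)
    · obtain ⟨u, huω, huR, hau, huz⟩ := hQ.2 hzR
      refine hau.trans (reachable_of_reachable_square hφ hness hR huR (by omega) huω hwω ?_)
      refine (huz.mono (openGraph_mono ?_)).trans (SimpleGraph.Adj.reachable
        ⟨hzw, ⟨hz, .inl hzR⟩, ⟨hw, .inr (.inr rfl)⟩⟩)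
      rintro y ⟨hy, hy' | hy'⟩
      · exact ⟨hy, .inl hy'⟩
      · exact ⟨hy, .inr (.inl hy')⟩
  · rcases le_or_gt R (supNorm z) with hzR | hzR
    · exact ⟨z, hout z hz hzR, by omega, hQ.1 hzR, SimpleGraph.Adj.reachable
        ⟨hzw, ⟨hz, .inr rfl⟩, ⟨hw, .inl hwR⟩⟩⟩
    · obtain ⟨u, huω, huR, hau, huz⟩ := hQ.2 hzR
      exact ⟨u, huω, huR, hau, huz.trans (SimpleGraph.Adj.reachable
        ⟨hzw, ⟨hz, .inl hzR⟩, ⟨hw, .inl hwR⟩⟩)⟩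

theorem reachable_shiftConfig {ω : Config} {a b : Site} (x : Site)
    (h : (openGraph ω).Reachable a b) :
    (openGraph (shiftConfig x ω)).Reachable (a - x) (b - x) := by
  refine reachable_induction
    (fun z => (openGraph (shiftConfig x ω)).Reachable (a - x) (z - x)) h (.refl _) ?_
  intro z w hzw hz hw hQ
  refine hQ.trans (SimpleGraph.Adj.reachable ⟨?_, ?_, ?_⟩)
  · simpa [adjZ2] using hzw
  · simpa [shiftConfig] using hz
  · simpa [shiftConfig] using hw

theorem shiftConfig_neg_shiftConfig (x : Site) (ω : Config) :
    shiftConfig (-x) (shiftConfig x ω) = ω := by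
  ext z
  simp [shiftConfig]

theorem shiftConfig_union_enhAt (φ : Config → Config) (x : Site) (ω : Config) :
    shiftConfig x (ω ∪ enhAt φ x ω) = shiftConfig x ω ∪ φ (shiftConfig x ω) := by
  ext z
  simp [shiftConfig, enhAt]

theorem reachable_of_reachable_union_enhAt {R₀ : ℝ} {φ : Config → Config}
    (hφ : IsEnhancement R₀ φ) (hness : ¬ Essential adjZ2 φ) {R : ℕ} (hR : R₀ < R) {ω : Config}
    {a b x : Site} (ha : R ≤ supNorm (a - x)) (hb : R ≤ supNorm (b - x))
    (hab : (openGraph (ω ∪ enhAt φ x ω)).Reachable a b) : (openGraph ω).Reachable a b := by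
  have h := reachable_shiftConfig x hab
  rw [shiftConfig_union_enhAt] at h
  have h' := reachable_shiftConfig (-x) (reachable_of_reachable_union hφ hness hR ha hb h)
  rwa [shiftConfig_neg_shiftConfig, sub_neg_eq_add, sub_neg_eq_add, sub_add_cancel,
    sub_add_cancel] at h'

/-! ### Simultaneous enhancements -/

theorem enhAt_mono {φ : Config → Config} (hmono : Monotonic φ) (x : Site) {ω ω' : Config}
    (h : ω ⊆ ω') : enhAt φ x ω ⊆ enhAt φ x ω' :=
  image_mono (hmono _ _ fun _ hy => h hy)

/-- The result of enhancing a configuration successively at the sites of a list. -/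
def enhanceList (φ : Config → Config) (ω : Config) : List Site → Config
  | [] => ω
  | x :: l => enhanceList φ ω l ∪ enhAt φ x (enhanceList φ ω l)

theorem subset_enhanceList (φ : Config → Config) (ω : Config) (l : List Site) :
    ω ⊆ enhanceList φ ω l := by
  induction l with
  | nil => exact subset_rfl
  | cons x l ih => exact ih.trans subset_union_left

theorem enhAt_subset_enhanceList {φ : Config → Config} (hmono : Monotonic φ) (ω : Config)
    {l : List Site} {x : Site} (hx : x ∈ l) : enhAt φ x ω ⊆ enhanceList φ ω l := by
  induction l with
  | nil => simp at hx
  | cons y l ih =>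
    rcases List.mem_cons.1 hx with rfl | hx
    · exact (enhAt_mono hmono x (subset_enhanceList φ ω l)).trans subset_union_right
    · exact (ih hx).trans subset_union_left

theorem reachable_of_reachable_enhanceList {R₀ : ℝ} {φ : Config → Config}
    (hφ : IsEnhancement R₀ φ) (hness : ¬ Essential adjZ2 φ) {R : ℕ} (hR : R₀ < R) {ω : Config}
    {a b : Site} {l : List Site} (hl : ∀ x ∈ l, R ≤ supNorm (a - x) ∧ R ≤ supNorm (b - x))
    (hab : (openGraph (enhanceList φ ω l)).Reachable a b) : (openGraph ω).Reachable a b := by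
  induction l with
  | nil => exact hab
  | cons x l ih =>
    obtain ⟨ha, hb⟩ := hl x (by simp)
    exact ih (fun y hy => hl y (by simp [hy]))
      (reachable_of_reachable_union_enhAt hφ hness hR ha hb hab)

/-- Only finitely many of the enhancements are needed to join two given sites. -/
theorem exists_finset_reachable {ω : Config} {ψ : Site → Config} {S : Set Site} {a b : Site}
    (hab : (openGraph (ω ∪ ⋃ x ∈ S, ψ x)).Reachable a b) :
    ∃ T : Finset Site, ↑T ⊆ S ∧ (openGraph (ω ∪ ⋃ x ∈ T, ψ x)).Reachable a b := by
  classical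
  have hfin : ∀ z ∈ ω ∪ ⋃ x ∈ S, ψ x,
      ∃ T : Finset Site, ↑T ⊆ S ∧ z ∈ ω ∪ ⋃ x ∈ T, ψ x := by
    rintro z (hz | hz)
    · exact ⟨∅, by simp, .inl hz⟩
    · obtain ⟨x, hx, hz⟩ := mem_iUnion₂.1 hz
      exact ⟨{x}, by simpa using hx, .inr (by simpa using hz)⟩
  have hmono : ∀ {T T' : Finset Site}, T ⊆ T' →
      ω ∪ ⋃ x ∈ T, ψ x ⊆ ω ∪ ⋃ x ∈ T', ψ x := fun h =>
    union_subset_union_right _ (biUnion_subset_biUnion_left h)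
  refine reachable_induction
    (fun y => ∃ T : Finset Site, ↑T ⊆ S ∧ (openGraph (ω ∪ ⋃ x ∈ T, ψ x)).Reachable a y)
    hab ⟨∅, by simp, .refl _⟩ ?_
  rintro z w hzw hz hw ⟨T, hT, hQ⟩
  obtain ⟨T₁, hT₁, hz⟩ := hfin z hz
  obtain ⟨T₂, hT₂, hw⟩ := hfin w hw
  refine ⟨T ∪ (T₁ ∪ T₂), by simp [hT, hT₁, hT₂], ?_⟩
  refine (hQ.mono (openGraph_mono (hmono Finset.subset_union_left))).trans
    (SimpleGraph.Adj.reachable ⟨hzw, hmono ?_ hz, hmono ?_ hw⟩)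
  · exact Finset.subset_union_left.trans Finset.subset_union_right
  · exact Finset.subset_union_right.trans Finset.subset_union_right

/-- The square of radius `K` centred at `x`. -/
noncomputable def square (K : ℕ) (x : Site) : Finset Site :=
  Finset.Icc (x.1 - K) (x.1 + K) ×ˢ Finset.Icc (x.2 - K) (x.2 + K)

theorem mem_square {K : ℕ} {x y : Site} : y ∈ square K x ↔ supNorm (y - x) ≤ K := by
  simp only [square, Finset.mem_product, Finset.mem_Icc, supNorm, Prod.fst_sub, Prod.snd_sub]
  omega

theorem card_square (K : ℕ) (x : Site) : (square K x).card = (2 * K + 1) ^ 2 := by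
  rw [square, Finset.card_product, Int.card_Icc, Int.card_Icc, sq]
  congr 1 <;> omega

theorem enhAt_subset_square {R₀ : ℝ} {φ : Config → Config} (hφ : IsEnhancement R₀ φ) {R : ℕ}
    (hR : R₀ < R) {ω : Config} {a x : Site} (ha : supNorm (a - x) < R) :
    enhAt φ x ω ⊆ square (2 * R) a := by
  rintro _ ⟨z, hz, rfl⟩
  have := supNorm_lt_of_mem_siteBall hR (hφ.2.1 _ hz)
  rw [Finset.mem_coe, mem_square]
  simp only [supNorm, Prod.fst_sub, Prod.snd_sub, Prod.fst_add, Prod.snd_add] at *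
  omega

/-- If a monotonic nonessential enhancement joins two sites, then these can be joined without
enhancement by opening all sites near them. -/
theorem connectedIn_of_connectedIn_enhanced {R₀ : ℝ} {φ : Config → Config}
    (hφ : IsEnhancement R₀ φ) (hmono : Monotonic φ) (hness : ¬ Essential adjZ2 φ) {R : ℕ}
    (hR : R₀ < R) {ω : Config} {α : Site → Bool} {a b : Site}
    (hab : ConnectedIn adjZ2 (enhanced φ ω α) a b) :
    ConnectedIn adjZ2 (ω ∪ ↑(square (2 * R) a ∪ square (2 * R) b)) a b := by
  set ω' : Config := ω ∪ ↑(square (2 * R) a ∪ square (2 * R) b)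
  have haω' : a ∈ ω' := .inr (by simp [mem_square, supNorm])
  refine connectedIn_iff.2 ⟨haω', ?_⟩
  set S : Set Site := {x | R ≤ supNorm (a - x) ∧ R ≤ supNorm (b - x)}
  have hsub : enhanced φ ω α ⊆ ω' ∪ ⋃ x ∈ S, enhAt φ x ω' := by
    rintro z (hz | ⟨x, -, hz⟩)
    · exact .inl (.inl hz)
    · rcases lt_or_ge (supNorm (a - x)) R with ha | ha
      · refine .inl (.inr ?_)
        rw [Finset.coe_union]
        exact .inl (enhAt_subset_square hφ hR ha hz)
      rcases lt_or_ge (supNorm (b - x)) R with hb | hb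
      · refine .inl (.inr ?_)
        rw [Finset.coe_union]
        exact .inr (enhAt_subset_square hφ hR hb hz)
      · exact .inr (mem_iUnion₂.2 ⟨x, ⟨ha, hb⟩, enhAt_mono hmono x subset_union_left hz⟩)
  obtain ⟨T, hTS, hT⟩ :=
    exists_finset_reachable ((connectedIn_iff.1 hab).2.mono (openGraph_mono hsub))
  refine reachable_of_reachable_enhanceList hφ hness hR (l := T.toList)
    (fun x hx => hTS (Finset.mem_toList.1 hx)) (hT.mono (openGraph_mono ?_))
  refine union_subset (subset_enhanceList φ ω' _) (iUnion₂_subset fun x hx => ?_)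
  exact enhAt_subset_enhanceList hmono ω' (Finset.mem_toList.2 hx)

/-! ### Bernoulli measures -/

theorem measurableSet_cylinder (F : Finset Site) (b : Site → Bool) :
    MeasurableSet (cylinder F b) := by
  have : cylinder F b = ⋂ x ∈ F, (fun η : Site → Bool => η x) ⁻¹' {b x} := by
    ext η
    simp [cylinder]
  rw [this]
  exact F.measurableSet_biInter fun x _ => measurable_pi_apply x (measurableSet_singleton _)

theorem isPiSystem_cylinder : IsPiSystem {A | ∃ F b, A = cylinder F b} := by
  classical
  rintro _ ⟨F, b, rfl⟩ _ ⟨G, c, rfl⟩ ⟨η, hη₁, hη₂⟩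
  refine ⟨F ∪ G, η, Set.ext fun ξ => ⟨fun ⟨h₁, h₂⟩ x hx => ?_, fun h => ⟨fun x hx => ?_,
    fun x hx => ?_⟩⟩⟩
  · rcases Finset.mem_union.1 hx with hx | hx
    · rw [h₁ x hx, hη₁ x hx]
    · rw [h₂ x hx, hη₂ x hx]
  · rw [h x (Finset.mem_union_left _ hx), hη₁ x hx]
  · rw [h x (Finset.mem_union_right _ hx), hη₂ x hx]

theorem generateFrom_cylinder :
    (inferInstance : MeasurableSpace (Site → Bool)) =
      MeasurableSpace.generateFrom {A | ∃ F b, A = cylinder F b} := by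
  refine le_antisymm (iSup_le fun x => ?_) (MeasurableSpace.generateFrom_le ?_)
  · rintro _ ⟨t, -, rfl⟩
    have : (fun η : Site → Bool => η x) ⁻¹' t = ⋃ i ∈ t, cylinder {x} fun _ => i := by
      ext η
      simp [cylinder]
    rw [this]
    exact .biUnion (to_countable t) fun i _ =>
      MeasurableSpace.measurableSet_generateFrom ⟨_, _, rfl⟩
  · rintro _ ⟨F, b, rfl⟩
    exact measurableSet_cylinder F b

/-- Forcing a site to be open amounts to conditioning on its being open. -/
theorem IsBernoulli.smul_map_update {p : ℝ} {μ : Measure (Site → Bool)} (hμ : IsBernoulli p μ)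
    (x : Site) :
    ENNReal.ofReal p • μ.map (fun η => Function.update η x true) =
      μ.restrict {η | η x = true} := by
  classical
  have := hμ.1
  have hmeas : Measurable fun η : Site → Bool => Function.update η x true :=
    measurable_update_left
  have : IsFiniteMeasure (ENNReal.ofReal p • μ.map fun η => Function.update η x true) :=
    Measure.smul_finite _ ENNReal.ofReal_ne_top
  have hcyl : ∀ F b, (ENNReal.ofReal p • μ.map (fun η => Function.update η x true))
      (cylinder F b) = μ.restrict {η | η x = true} (cylinder F b) := by
    intro F b
    rw [Measure.smul_apply, Measure.map_apply hmeas (measurableSet_cylinder F b),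
      Measure.restrict_apply (measurableSet_cylinder F b), smul_eq_mul]
    by_cases hb : x ∈ F ∧ b x = false
    · have h₁ : (fun η : Site → Bool => Function.update η x true) ⁻¹' cylinder F b = ∅ := by
        refine eq_empty_of_forall_notMem fun η hη => ?_
        simpa [hb.2] using hη x hb.1
      have h₂ : cylinder F b ∩ {η | η x = true} = ∅ := by
        refine eq_empty_of_forall_notMem fun η hη => ?_
        have := hη.1 x hb.1
        rw [hη.2, hb.2] at this
        exact absurd this (by simp)
      simp [h₁, h₂]
    have hb' : x ∈ F → b x = true := by simpa using hb
    have h₁ : (fun η : Site → Bool => Function.update η x true) ⁻¹' cylinder F b =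
        cylinder (F.erase x) (Function.update b x true) := by
      ext η
      refine ⟨fun h y hy => ?_, fun h y hy => ?_⟩
      · have := h y (Finset.mem_of_mem_erase hy)
        simpa [Finset.ne_of_mem_erase hy] using this
      · rcases eq_or_ne y x with rfl | hyx
        · simp [hb' hy]
        · simpa [hyx] using h y (Finset.mem_erase.2 ⟨hyx, hy⟩)
    have h₂ : cylinder F b ∩ {η | η x = true} =
        cylinder (insert x (F.erase x)) (Function.update b x true) := by
      ext η
      refine ⟨fun h y hy => ?_, fun h => ⟨fun y hy => ?_, ?_⟩⟩
      · rcases eq_or_ne y x with rfl | hyx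
        · simpa using h.2
        · have hyF : y ∈ F := by simpa [hyx] using hy
          simpa [hyx] using h.1 y hyF
      · rcases eq_or_ne y x with rfl | hyx
        · simpa [hb' hy] using h y (by simp)
        · simpa [hyx] using h y (by simp [hyx, hy])
      · simpa using h x (by simp)
    rw [h₁, h₂, hμ.2, hμ.2, Finset.prod_insert (Finset.notMem_erase x F)]
    simp
  refine ext_of_generate_finite _ generateFrom_cylinder isPiSystem_cylinder ?_ ?_
  · rintro _ ⟨F, b, rfl⟩
    exact hcyl F b
  · have huniv : cylinder ∅ (fun _ => true) = univ := by
      ext η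
      simp [cylinder]
    rw [← huniv]
    exact hcyl _ _

theorem toConfig_update (η : Site → Bool) (x : Site) :
    toConfig (Function.update η x true) = insert x (toConfig η) := by
  ext y
  by_cases h : y = x <;> simp [toConfig, Function.update_apply, h]

/-- Finite energy: opening finitely many sites increases probabilities by at most a power
of `1 / p`. -/
theorem IsBernoulli.pow_card_mul_le {p : ℝ} {μ : Measure (Site → Bool)} (hμ : IsBernoulli p μ)
    (F : Finset Site) (A : Set Config) :
    ENNReal.ofReal p ^ F.card * μ {η | toConfig η ∪ ↑F ∈ A} ≤ μ {η | toConfig η ∈ A} := by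
  classical
  induction F using Finset.induction_on generalizing A with
  | empty => simp
  | insert x F hx ih =>
    rw [Finset.card_insert_of_notMem hx, pow_succ, mul_assoc]
    refine le_trans (mul_le_mul_right ?_ _) (ih A)
    have hmeas : Measurable fun η : Site → Bool => Function.update η x true :=
      measurable_update_left
    have hset : {η | toConfig η ∪ ↑(insert x F) ∈ A} =
        (fun η => Function.update η x true) ⁻¹' {η | toConfig η ∪ ↑F ∈ A} := by
      ext η
      simp [toConfig_update, insert_union]
    calc ENNReal.ofReal p * μ {η | toConfig η ∪ ↑(insert x F) ∈ A}
        ≤ ENNReal.ofReal p * μ.map (fun η => Function.update η x true)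
            {η | toConfig η ∪ ↑F ∈ A} := by
          rw [hset]
          refine mul_le_mul_right ?_ _
          exact Measure.le_map_apply hmeas.aemeasurable _
      _ = μ.restrict {η | η x = true} {η | toConfig η ∪ ↑F ∈ A} := by
          rw [← hμ.smul_map_update x, Measure.smul_apply, smul_eq_mul]
      _ ≤ μ {η | toConfig η ∪ ↑F ∈ A} := Measure.restrict_apply_le _ _

theorem pcOf_le_one (adj : Site → Site → Prop) (P : ℝ → Measure (Site → Bool)) :
    pcOf adj P ≤ 1 :=
  Real.sSup_le (fun _ hp => hp.1.2) zero_le_one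

theorem chi_le_chiEnh (φ : Config → Config) (μ ν : Measure (Site → Bool))
    [IsProbabilityMeasure μ] [IsProbabilityMeasure ν] :
    chi adjZ2 μ ≤ chiEnh adjZ2 φ μ ν := by
  refine ENNReal.tsum_le_tsum fun x => ?_
  calc μ {η | ConnectedIn adjZ2 (toConfig η) 0 x}
      = (μ.prod ν) ({η | ConnectedIn adjZ2 (toConfig η) 0 x} ×ˢ univ) := by
        rw [Measure.prod_prod, measure_univ, mul_one]
    _ ≤ _ := measure_mono fun ηα h => ConnectedIn.mono subset_union_left h.1

theorem pow_mul_chiEnh_le {R₀ : ℝ} {φ : Config → Config} (hφ : IsEnhancement R₀ φ)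
    (hmono : Monotonic φ) (hness : ¬ Essential adjZ2 φ) {R : ℕ} (hR : R₀ < R) {p : ℝ}
    (hp : p ≤ 1) {μ ν : Measure (Site → Bool)} (hμ : IsBernoulli p μ) [IsProbabilityMeasure ν] :
    ENNReal.ofReal p ^ (2 * (4 * R + 1) ^ 2) * chiEnh adjZ2 φ μ ν ≤ chi adjZ2 μ := by
  have := hμ.1
  unfold chiEnh
  rw [← ENNReal.tsum_mul_left]
  refine ENNReal.tsum_le_tsum fun x => ?_
  set F : Finset Site := square (2 * R) 0 ∪ square (2 * R) x
  have hcard : F.card ≤ 2 * (4 * R + 1) ^ 2 := by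
    refine (Finset.card_union_le _ _).trans_eq ?_
    rw [card_square, card_square]
    ring
  refine le_trans ?_ (hμ.pow_card_mul_le F {ω | ConnectedIn adjZ2 ω 0 x})
  refine mul_le_mul' (pow_le_pow_of_le_one zero_le ?_ hcard) ?_
  · simpa using ENNReal.ofReal_le_ofReal hp
  · calc _ ≤ (μ.prod ν) ({η | ConnectedIn adjZ2 (toConfig η ∪ ↑F) 0 x} ×ˢ univ) :=
          measure_mono fun ηα h =>
            ⟨connectedIn_of_connectedIn_enhanced hφ hmono hness hR h, mem_univ _⟩
      _ = _ := by
          rw [Measure.prod_prod, measure_univ, mul_one]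
          rfl

/-- for a monotonic nonessential enhancement there is a constant
`c₂ ∈ (0,∞)`, depending only on the enhancement, such that for all `s ∈ [0,1]` and
`p ∈ (0, p_c)`: `χ(p) ≤ χ(p,s) ≤ p^{−c₂} · χ(p)`. -/
theorem chi_comparison
    (P : ℝ → Measure (Site → Bool))
    (hP : ∀ p ∈ Icc (0:ℝ) 1, IsBernoulli p (P p))
    (R₀ : ℝ) (φ : Config → Config) (hφ : IsEnhancement R₀ φ)
    (hmono : Monotonic φ) (hness : ¬ Essential adjZ2 φ) :
    ∃ c₂ : ℝ, 0 < c₂ ∧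
      ∀ s ∈ Icc (0:ℝ) 1, ∀ p : ℝ, 0 < p → p < pcOf adjZ2 P →
        chi adjZ2 (P p) ≤ chiEnh adjZ2 φ (P p) (P s) ∧
          chiEnh adjZ2 φ (P p) (P s) ≤ ENNReal.ofReal (p ^ (-c₂)) * chi adjZ2 (P p) := by
  obtain ⟨R, hR⟩ := exists_nat_gt R₀
  refine ⟨(2 * (4 * R + 1) ^ 2 : ℕ), by positivity, fun s hs p hp0 hppc => ?_⟩
  have hp1 : p ≤ 1 := hppc.le.trans (pcOf_le_one adjZ2 P)
  have hμ := hP p ⟨hp0.le, hp1⟩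
  have := hμ.1
  have := (hP s hs).1
  refine ⟨chi_le_chiEnh φ _ _, ?_⟩
  have hp : ENNReal.ofReal p ≠ 0 := by simpa using hp0
  rw [Real.rpow_neg hp0.le, Real.rpow_natCast, ENNReal.ofReal_inv_of_pos (by positivity),
    ENNReal.ofReal_pow hp0.le, mul_comm, ← div_eq_mul_inv,
    ENNReal.le_div_iff_mul_le (.inl (pow_ne_zero _ hp)) (.inl (by finiteness)), mul_comm]
  exact pow_mul_chiEnh_le hφ hmono hness hR hp1 hμ

end PercEnh
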